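/- There is a universal constant C₆ > 1 such that the following holds. Let m, ℓ ∈ ℤ₊ with ℓ ≤ m ≤ 2ℓ, let K, R > 0, and let a ∈ Λ. Suppose u : P_{a;m,ℓ} → ℝ satisfies |u(b) + u(b-ξ) + u(b+η)| ≤ R for every b ∈ P_{a-η;m,ℓ-1}. If |u| ≤ K on P_{a;m,0} and the number of points b ∈ P_{a;m,ℓ} with |u(b)| > K is at most 10^{-5}·m·ℓ, then |u| ≤ (K+R)·C₆^{ℓ} on P_{a;m,⌊ℓ/2⌋}. -/

import Mathlib

/-- The lattice vector `ξ = (-1, 0)` of the triangular lattice in `ℝ²`. -/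
noncomputable def xiv : ℝ × ℝ := (-1, 0)

/-- The lattice vector `η = (1/2, √3/2)` of the triangular lattice in `ℝ²`. -/
noncomputable def etav : ℝ × ℝ := (1 / 2, Real.sqrt 3 / 2)

/-- The triangular lattice `Λ = {sξ + tη : s, t ∈ ℤ}`. -/
def Lam : Set (ℝ × ℝ) := {p | ∃ s t : ℤ, p = (s : ℝ) • xiv + (t : ℝ) • etav}

/-- The trapezoid `P_{a;m,ℓ} = {a + sξ + tη : -ℓ ≤ t ≤ 0, -m+t ≤ s ≤ 0}`. -/
def Pset (a : ℝ × ℝ) (m l : ℕ) : Set (ℝ × ℝ) :=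
  {p | ∃ s t : ℤ, -(l : ℤ) ≤ t ∧ t ≤ 0 ∧ -(m : ℤ) + t ≤ s ∧ s ≤ 0 ∧
    p = a + (s : ℝ) • xiv + (t : ℝ) • etav}

/-- A product of distinct positive natural numbers is at least the factorial of their number. -/
theorem factorial_card_le_prod_of_injOn {α : Type*} (s : Finset α) (f : α → ℕ)
    (hf : Set.InjOn f s) (hpos : ∀ a ∈ s, 0 < f a) :
    s.card.factorial ≤ ∏ a ∈ s, f a := by
  classical
  have key : ∀ T : Finset ℕ, (∀ t ∈ T, 0 < t) → T.card.factorial ≤ ∏ t ∈ T, t := by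
    intro T
    induction T using Finset.induction_on_max with
    | empty => simp
    | insert a T hlt ih =>
      intro h
      have ha : a ∉ T := fun h' => lt_irrefl _ (hlt a h')
      have hsub : insert a T ⊆ Finset.Icc 1 a := by
        intro t ht
        rw [Finset.mem_Icc]
        refine ⟨h t ht, ?_⟩
        rcases Finset.mem_insert.1 ht with rfl | ht
        · exact le_rfl
        · exact (hlt t ht).le
      have hcard := Finset.card_le_card hsub
      rw [Nat.card_Icc, Finset.card_insert_of_notMem ha] at hcard
      rw [Finset.card_insert_of_notMem ha, Finset.prod_insert ha, Nat.factorial_succ]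
      exact Nat.mul_le_mul (by omega) (ih fun t ht => h t (Finset.mem_insert_of_mem ht))
  have := key (s.image f) (by simpa using hpos)
  rwa [Finset.card_image_of_injOn hf, Finset.prod_image hf] at this

/-- The product of the distances from `i` to `d` other integers is at least `d! / 2 ^ d`. -/
theorem factorial_card_le_two_pow_mul_prod_abs_sub (s : Finset ℕ) (i : ℕ) (hi : i ∉ s) :
    (s.card.factorial : ℝ) ≤ 2 ^ s.card * ∏ j ∈ s, |(i : ℝ) - j| := by
  set A := s.filter (· < i) with hA
  set B := s.filter (¬ · < i) with hB
  have hcard : A.card + B.card = s.card := Finset.card_filter_add_card_filter_not _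
  have hAp : (A.card.factorial : ℝ) ≤ ∏ j ∈ A, |(i : ℝ) - j| := by
    have h := factorial_card_le_prod_of_injOn A (fun j => i - j)
      (by intro x hx y hy h; simp [hA] at hx hy h; omega)
      (by intro x hx; simp [hA] at hx ⊢; omega)
    calc (A.card.factorial : ℝ) ≤ ((∏ j ∈ A, (i - j) : ℕ) : ℝ) := by exact_mod_cast h
      _ = ∏ j ∈ A, |(i : ℝ) - j| := by
        rw [Nat.cast_prod]
        refine Finset.prod_congr rfl fun j hj => ?_
        have hj : j ≤ i := (Finset.mem_filter.1 hj).2.le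
        have hj' : (j : ℝ) ≤ i := by exact_mod_cast hj
        rw [Nat.cast_sub hj, abs_of_nonneg (by linarith)]
  have hBp : (B.card.factorial : ℝ) ≤ ∏ j ∈ B, |(i : ℝ) - j| := by
    have hlt : ∀ j ∈ B, i < j := by
      intro j hj
      have h1 := Finset.mem_filter.1 hj
      have : j ≠ i := by rintro rfl; exact hi h1.1
      omega
    have h := factorial_card_le_prod_of_injOn B (fun j => j - i)
      (by
        intro x hx y hy h
        have := hlt x hx
        have := hlt y hy
        simp only at h
        omega)
      (by intro x hx; have := hlt x hx; omega)
    calc (B.card.factorial : ℝ) ≤ ((∏ j ∈ B, (j - i) : ℕ) : ℝ) := by exact_mod_cast h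
      _ = ∏ j ∈ B, |(i : ℝ) - j| := by
        rw [Nat.cast_prod]
        refine Finset.prod_congr rfl fun j hj => ?_
        have hj := (hlt j hj).le
        have hj' : (i : ℝ) ≤ j := by exact_mod_cast hj
        rw [Nat.cast_sub hj, abs_sub_comm, abs_of_nonneg (by linarith)]
  have hch : s.card.factorial ≤ 2 ^ s.card * (A.card.factorial * B.card.factorial) := by
    rw [← hcard, ← Nat.add_choose_mul_factorial_mul_factorial, mul_assoc]
    exact Nat.mul_le_mul_right _ (Nat.choose_le_two_pow _ _)
  calc (s.card.factorial : ℝ)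
      ≤ 2 ^ s.card * (A.card.factorial * B.card.factorial) := by exact_mod_cast hch
    _ ≤ 2 ^ s.card * ((∏ j ∈ A, |(i : ℝ) - j|) * ∏ j ∈ B, |(i : ℝ) - j|) := by gcongr
    _ = 2 ^ s.card * ∏ j ∈ s, |(i : ℝ) - j| := by
      rw [hA, hB, Finset.prod_filter_mul_prod_filter_not]

/-- A discrete Remez inequality: a polynomial of degree less than `|S|` that is bounded by `B` on
a set `S ⊆ {0, …, N}` is bounded on all of `{0, …, N}`. -/
theorem abs_eval_le_of_abs_eval_le_on (P : Polynomial ℝ) (S : Finset ℕ) (N x : ℕ) (B : ℝ)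
    (hdeg : P.degree < S.card) (hS : ∀ s ∈ S, s ≤ N) (hx : x ≤ N)
    (hB : ∀ s ∈ S, |P.eval (s : ℝ)| ≤ B) :
    |P.eval (x : ℝ)| ≤ S.card * (B * (2 ^ S.card * 3 ^ N)) := by
  have hinj : Set.InjOn (fun n : ℕ => (n : ℝ)) S := fun a _ b _ h => Nat.cast_injective h
  rw [Lagrange.eq_interpolate hinj hdeg, Lagrange.interpolate_apply, Polynomial.eval_finsetSum]
  refine (Finset.abs_sum_le_sum_abs _ _).trans ?_
  rw [← nsmul_eq_mul]
  refine Finset.sum_le_card_nsmul _ _ _ fun i hi => ?_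
  rw [Polynomial.eval_mul, Polynomial.eval_C, abs_mul]
  refine mul_le_mul (hB i hi) ?_ (abs_nonneg _) ((abs_nonneg _).trans (hB i hi))
  rw [Lagrange.basis, Polynomial.eval_prod, Finset.abs_prod]
  have hterm : ∀ j ∈ S.erase i,
      |Polynomial.eval (x : ℝ) (Lagrange.basisDivisor (i : ℝ) (j : ℝ))|
        = |(x : ℝ) - j| / |(i : ℝ) - j| := by
    intro j _
    simp [Lagrange.basisDivisor, abs_mul, abs_inv, div_eq_inv_mul]
  rw [Finset.prod_congr rfl hterm, Finset.prod_div_distrib]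
  have hden : 0 < ∏ j ∈ S.erase i, |(i : ℝ) - j| := by
    refine Finset.prod_pos fun j hj => abs_pos.2 (sub_ne_zero.2 ?_)
    exact_mod_cast (Finset.ne_of_mem_erase hj).symm
  have hnum : ∏ j ∈ S.erase i, |(x : ℝ) - j| ≤ (N : ℝ) ^ (S.erase i).card := by
    rw [← Finset.prod_const]
    refine Finset.prod_le_prod (fun _ _ => abs_nonneg _) fun j hj => ?_
    have hjN : (j : ℝ) ≤ N := by exact_mod_cast hS j (Finset.mem_of_mem_erase hj)
    have hxN : (x : ℝ) ≤ N := by exact_mod_cast hx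
    have hj0 : (0 : ℝ) ≤ j := Nat.cast_nonneg j
    have hx0 : (0 : ℝ) ≤ x := Nat.cast_nonneg x
    exact abs_le.2 ⟨by linarith, by linarith⟩
  have hfact := factorial_card_le_two_pow_mul_prod_abs_sub _ i (Finset.notMem_erase i S)
  have hexp : (N : ℝ) ^ (S.erase i).card ≤ 3 ^ N * (S.erase i).card.factorial := by
    have h := Real.pow_div_factorial_le_exp (N : ℝ) (Nat.cast_nonneg N) (S.erase i).card
    rw [div_le_iff₀ (by positivity)] at h
    refine h.trans (mul_le_mul_of_nonneg_right ?_ (Nat.cast_nonneg _))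
    rw [← Real.exp_one_pow]
    exact pow_le_pow_left₀ (Real.exp_pos 1).le Real.exp_one_lt_three.le N
  have hcard : (2 : ℝ) ^ (S.erase i).card ≤ 2 ^ S.card :=
    pow_le_pow_right₀ (by norm_num) (Finset.card_le_card (Finset.erase_subset i S))
  rw [div_le_iff₀ hden]
  calc ∏ j ∈ S.erase i, |(x : ℝ) - j| ≤ 3 ^ N * (S.erase i).card.factorial := hnum.trans hexp
    _ ≤ 3 ^ N * (2 ^ (S.erase i).card * ∏ j ∈ S.erase i, |(i : ℝ) - j|) := by gcongr
    _ ≤ 3 ^ N * (2 ^ S.card * ∏ j ∈ S.erase i, |(i : ℝ) - j|) := by gcongr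
    _ = 2 ^ S.card * 3 ^ N * ∏ j ∈ S.erase i, |(i : ℝ) - j| := by ring

/-- Approximate solutions of `g (i + 1) (j + 1) = g i (j + 1) + g i j` are close to exact
polynomial solutions. -/
theorem abs_sub_sum_choose_le (g : ℕ → ℕ → ℝ) (m l : ℕ) (K R : ℝ) (hK : 0 ≤ K) (hR : 0 ≤ R)
    (h0 : ∀ i ≤ m, |g i 0| ≤ K)
    (hrec : ∀ j < l, ∀ i ≤ m + j, |g (i + 1) (j + 1) - (g i (j + 1) + g i j)| ≤ R) :
    ∀ i j, j ≤ l → i ≤ m + j →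
      |g i j - ∑ k ∈ Finset.range j, g 0 (j - k) * (i.choose k : ℝ)| ≤ (K + R) * 3 ^ (i + j) := by
  intro i
  induction i with
  | zero =>
    intro j hj _
    rcases j with _ | j
    · simpa using (h0 0 (Nat.zero_le _)).trans (by linarith)
    · rw [Finset.sum_range_succ']
      simp
      positivity
  | succ i ih =>
    intro j hj hi
    rcases j with _ | j
    · have h1 : (1 : ℝ) ≤ 3 ^ (i + 1) := one_le_pow₀ (by norm_num)
      have := h0 (i + 1) (by omega)
      simp
      nlinarith
    · have h1 := ih (j + 1) hj (by omega)
      have h2 := ih j (by omega) (by omega)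
      have h3 := hrec j (by omega) i (by omega)
      have hpascal : ∑ k ∈ Finset.range (j + 1), g 0 (j + 1 - k) * ((i + 1).choose k : ℝ)
          = ∑ k ∈ Finset.range (j + 1), g 0 (j + 1 - k) * (i.choose k : ℝ)
            + ∑ k ∈ Finset.range j, g 0 (j - k) * (i.choose k : ℝ) := by
        rw [Finset.sum_range_succ', Finset.sum_range_succ' _ j]
        simp only [Nat.choose_succ_succ, Nat.cast_add, mul_add, Finset.sum_add_distrib,
          Nat.add_sub_add_right, Nat.choose_zero_right]
        ring
      rw [hpascal]
      set Q1 := ∑ k ∈ Finset.range (j + 1), g 0 (j + 1 - k) * (i.choose k : ℝ)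
      set Q2 := ∑ k ∈ Finset.range j, g 0 (j - k) * (i.choose k : ℝ)
      have hp : (1 : ℝ) ≤ 3 ^ (i + j) := one_le_pow₀ (by norm_num)
      have e1 : (3 : ℝ) ^ (i + (j + 1)) = 3 * 3 ^ (i + j) := by rw [← add_assoc, pow_succ]; ring
      have e2 : (3 : ℝ) ^ (i + 1 + (j + 1)) = 9 * 3 ^ (i + j) := by
        rw [show i + 1 + (j + 1) = i + j + 2 by ring, pow_add]; ring
      rw [e1] at h1
      rw [e2]
      rw [abs_le] at *
      constructor <;> nlinarith

/-- A combination of the binomials `n.choose k`, `k < j`, is a polynomial in `n` of degree less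
than `j`. -/
theorem exists_polynomial_eval_eq_sum_choose (c : ℕ → ℝ) (j : ℕ) :
    ∃ P : Polynomial ℝ, P.degree < j ∧
      ∀ n : ℕ, P.eval (n : ℝ) = ∑ k ∈ Finset.range j, c k * (n.choose k : ℝ) := by
  refine ⟨∑ k ∈ Finset.range j, Polynomial.C (c k / k.factorial) * descPochhammer ℝ k, ?_, ?_⟩
  · rw [← Polynomial.mem_degreeLT]
    refine Submodule.sum_mem _ fun k hk => ?_
    rw [Polynomial.mem_degreeLT]
    rw [← Polynomial.smul_eq_C_mul]
    refine (Polynomial.degree_smul_le _ _).trans_lt ?_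
    refine Polynomial.degree_le_natDegree.trans_lt ?_
    rw [descPochhammer_natDegree]
    exact_mod_cast Finset.mem_range.1 hk
  · intro n
    rw [Polynomial.eval_finsetSum]
    refine Finset.sum_congr rfl fun k _ => ?_
    rw [Polynomial.eval_mul, Polynomial.eval_C, descPochhammer_eval_eq_descFactorial,
      Nat.descFactorial_eq_factorial_mul_choose, Nat.cast_mul]
    field_simp

/-- The point of the lattice at position `i` of row `j` below `a`. -/
noncomputable def latticePoint (a : ℝ × ℝ) (i j : ℕ) : ℝ × ℝ :=
  a + (-(i : ℝ)) • xiv + (-(j : ℝ)) • etav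

theorem latticePoint_injective (a : ℝ × ℝ) :
    Function.Injective fun p : ℕ × ℕ => latticePoint a p.1 p.2 := by
  rintro ⟨i, j⟩ ⟨i', j'⟩ h
  have h3 : (0 : ℝ) < Real.sqrt 3 := Real.sqrt_pos.2 (by norm_num)
  simp only [latticePoint, xiv, etav, Prod.ext_iff, Prod.fst_add, Prod.snd_add, Prod.smul_fst,
    Prod.smul_snd, smul_eq_mul] at h
  obtain ⟨h1, h2⟩ := h
  have hj : (j : ℝ) = j' := by
    have : ((j : ℝ) - j') * Real.sqrt 3 = 0 := by linarith
    rcases mul_eq_zero.1 this with h | h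
    · linarith
    · exact absurd h h3.ne'
  have hi : (i : ℝ) = i' := by rw [hj] at h1; linarith
  exact Prod.ext (by exact_mod_cast hi) (by exact_mod_cast hj)

theorem mem_Pset_iff (a : ℝ × ℝ) (m l : ℕ) (b : ℝ × ℝ) :
    b ∈ Pset a m l ↔ ∃ i j : ℕ, j ≤ l ∧ i ≤ m + j ∧ b = latticePoint a i j := by
  constructor
  · rintro ⟨s, t, h1, h2, h3, h4, rfl⟩
    refine ⟨(-s).toNat, (-t).toNat, by omega, by omega, ?_⟩
    have hs : (((-s).toNat : ℤ) : ℝ) = -s := by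
      rw [Int.toNat_of_nonneg (by omega)]; push_cast; ring
    have ht : (((-t).toNat : ℤ) : ℝ) = -t := by
      rw [Int.toNat_of_nonneg (by omega)]; push_cast; ring
    rw [Int.cast_natCast] at hs ht
    rw [latticePoint, hs, ht, neg_neg, neg_neg]
  · rintro ⟨i, j, hj, hi, rfl⟩
    exact ⟨-i, -j, by omega, by omega, by omega, by omega, by simp [latticePoint]⟩

theorem Pset_finite (a : ℝ × ℝ) (m l : ℕ) : (Pset a m l).Finite := by
  refine ((Finset.range (m + l + 1) ×ˢ Finset.range (l + 1)).finite_toSet.image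
    fun p : ℕ × ℕ => latticePoint a p.1 p.2).subset fun b hb => ?_
  obtain ⟨i, j, hj, hi, rfl⟩ := (mem_Pset_iff a m l b).1 hb
  exact ⟨(i, j), by simp; omega, rfl⟩

/-- If a trapezoid has few bad points, then some row in its lower half contains at least as many
good points as its index. -/
theorem exists_row_card_le (a : ℝ × ℝ) (m l : ℕ) (hl : 0 < l) (p : ℝ × ℝ → Prop)
    (hp : (({b | b ∈ Pset a m l ∧ p b}.ncard : ℕ) : ℝ) ≤ (m : ℝ) * l / 10 ^ 5) :
    ∃ j, l / 2 < j ∧ j ≤ l ∧ ∃ S : Finset ℕ, S.card = j ∧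
      ∀ i ∈ S, i ≤ m + j ∧ ¬ p (latticePoint a i j) := by
  classical
  by_contra! hcon
  set bad : ℕ → Finset ℕ := fun j => {i ∈ Finset.range (m + j + 1) | p (latticePoint a i j)}
  have hbad : ∀ j ∈ Finset.Ioc (l / 2) l, m + 1 ≤ (bad j).card := by
    intro j hj
    rw [Finset.mem_Ioc] at hj
    by_contra! hlt
    have hadd := Finset.card_filter_add_card_filter_not (s := Finset.range (m + j + 1))
      (fun i => p (latticePoint a i j))
    rw [Finset.card_range] at hadd
    obtain ⟨S, hS, hScard⟩ := Finset.exists_subset_card_eq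
      (s := {i ∈ Finset.range (m + j + 1) | ¬ p (latticePoint a i j)}) (n := j)
      (by simp only [bad] at hlt; omega)
    obtain ⟨i, hi, h⟩ := hcon j hj.1 hj.2 S hScard
    have := Finset.mem_filter.1 (hS hi)
    exact this.2 (h (by have := Finset.mem_range.1 this.1; omega))
  set T : Finset (ℝ × ℝ) := ((Finset.Ioc (l / 2) l).sigma bad).image
    fun q => latticePoint a q.2 q.1
  have hTcard : T.card = ∑ j ∈ Finset.Ioc (l / 2) l, (bad j).card := by
    rw [← Finset.card_sigma]
    refine Finset.card_image_of_injective _ ?_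
    rintro ⟨j, i⟩ ⟨j', i'⟩ h
    have := latticePoint_injective a (a₁ := (i, j)) (a₂ := (i', j')) h
    simp only [Prod.mk.injEq] at this
    obtain ⟨rfl, rfl⟩ := this
    rfl
  have hsum : (l - l / 2) * (m + 1) ≤ T.card := by
    rw [hTcard, ← Nat.card_Ioc, ← smul_eq_mul]
    exact Finset.card_nsmul_le_sum _ _ _ hbad
  have hsub : (T : Set (ℝ × ℝ)) ⊆ {b | b ∈ Pset a m l ∧ p b} := by
    intro b hb
    obtain ⟨⟨j, i⟩, hq, rfl⟩ := Finset.mem_image.1 (Finset.mem_coe.1 hb)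
    rw [Finset.mem_sigma, Finset.mem_Ioc, Finset.mem_filter, Finset.mem_range] at hq
    obtain ⟨hj, hi, hpi⟩ := hq
    exact ⟨(mem_Pset_iff _ _ _ _).2 ⟨i, j, hj.2, by simp only at hi ⊢; omega, rfl⟩, hpi⟩
  have hle := Set.ncard_le_ncard hsub ((Pset_finite a m l).subset fun b hb => hb.1)
  rw [Set.ncard_coe_finset] at hle
  have h1 : l * (m + 1) ≤ 2 * {b | b ∈ Pset a m l ∧ p b}.ncard := by
    calc l * (m + 1) ≤ 2 * (l - l / 2) * (m + 1) := Nat.mul_le_mul_right _ (by omega)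
      _ = 2 * ((l - l / 2) * (m + 1)) := by ring
      _ ≤ _ := Nat.mul_le_mul_left _ (hsum.trans hle)
  have h2 : (l : ℝ) * (m + 1) ≤ 2 * ({b | b ∈ Pset a m l ∧ p b}.ncard : ℝ) := by
    exact_mod_cast h1
  have hl' : (1 : ℝ) ≤ l := by exact_mod_cast hl
  have hm : (0 : ℝ) ≤ m := Nat.cast_nonneg m
  nlinarith [mul_nonneg hm (zero_le_one.trans hl')]

/-- Bound on the upper half of a trapezoid, given smallness on the upper edge and on all
but a small fraction of the trapezoid. -/
theorem trapezoid_half_bound :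
    ∃ C₆ : ℝ, 1 < C₆ ∧
      ∀ m l : ℕ, 0 < m → 0 < l → l ≤ m → m ≤ 2 * l →
        ∀ K R : ℝ, 0 < K → 0 < R →
          ∀ a : ℝ × ℝ, a ∈ Lam →
            ∀ u : ℝ × ℝ → ℝ,
              (∀ b ∈ Pset (a - etav) m (l - 1),
                |u b + u (b - xiv) + u (b + etav)| ≤ R) →
              (∀ b ∈ Pset a m 0, |u b| ≤ K) →
              ((({b | b ∈ Pset a m l ∧ K < |u b|}).ncard : ℝ) ≤
                (m : ℝ) * (l : ℝ) / 10 ^ 5) →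
              ∀ b ∈ Pset a m (l / 2), |u b| ≤ (K + R) * C₆ ^ l := by
  refine ⟨104976, by norm_num, ?_⟩
  intro m l _ hl _ hml K R hK hR a _ u hrec htop hbad b hb
  set v : ℕ → ℕ → ℝ := fun i j => u (latticePoint a i j) with hv
  have hv0 : ∀ i ≤ m, |v i 0| ≤ K := fun i hi =>
    htop _ ((mem_Pset_iff _ _ _ _).2 ⟨i, 0, le_rfl, hi, rfl⟩)
  have hvrec : ∀ j < l, ∀ i ≤ m + j, |v i (j + 1) + v (i + 1) (j + 1) + v i j| ≤ R := by
    intro j hj i hi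
    have h := hrec (latticePoint (a - etav) i j)
      ((mem_Pset_iff _ _ _ _).2 ⟨i, j, by omega, hi, rfl⟩)
    have e1 : latticePoint (a - etav) i j = latticePoint a i (j + 1) := by
      simp only [latticePoint]; push_cast; module
    have e2 : latticePoint (a - etav) i j - xiv = latticePoint a (i + 1) (j + 1) := by
      simp only [latticePoint]; push_cast; module
    have e3 : latticePoint (a - etav) i j + etav = latticePoint a i j := by
      simp only [latticePoint]; module
    rwa [e2, e3, e1] at h
  have hsign : ∀ (i : ℕ) (x : ℝ), |(-1) ^ i * x| = |x| := by
    intro i x; rw [abs_mul, abs_pow, abs_neg, abs_one, one_pow, one_mul]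
  set g : ℕ → ℕ → ℝ := fun i j => (-1) ^ i * v i j with hg
  have happrox := abs_sub_sum_choose_le g m l K R hK.le hR.le
    (fun i hi => by rw [hg]; simpa only [hsign] using hv0 i hi)
    (fun j hj i hi => by
      have : g (i + 1) (j + 1) - (g i (j + 1) + g i j)
          = (-1) ^ (i + 1) * (v i (j + 1) + v (i + 1) (j + 1) + v i j) := by
        simp only [hg]; ring
      rw [this, hsign]
      exact hvrec j hj i hi)
  obtain ⟨j, hj1, hj2, S, hScard, hS⟩ := exists_row_card_le a m l hl (fun b => K < |u b|) hbad
  obtain ⟨P, hPdeg, hP⟩ := exists_polynomial_eval_eq_sum_choose (fun k => g 0 (j - k)) j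
  have hKR : 0 < K + R := by linarith
  have hone : (1 : ℝ) ≤ 81 ^ l := one_le_pow₀ (by norm_num)
  have hPg : ∀ i ≤ m + j, |g i j - P.eval (i : ℝ)| ≤ (K + R) * 81 ^ l := by
    intro i hi
    rw [hP]
    refine (happrox i j hj2 hi).trans (mul_le_mul_of_nonneg_left ?_ hKR.le)
    rw [show (81 : ℝ) = 3 ^ 4 by norm_num, ← pow_mul]
    exact pow_le_pow_right₀ (by norm_num) (by omega)
  have hPS : ∀ i ∈ S, |P.eval (i : ℝ)| ≤ 2 * ((K + R) * 81 ^ l) := by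
    intro i hi
    obtain ⟨hi1, hi2⟩ := hS i hi
    have h1 := hPg i hi1
    have h2 : |g i j| ≤ K := by rw [hg]; simpa only [hsign] using not_lt.1 hi2
    have h3 := abs_sub_abs_le_abs_sub (P.eval (i : ℝ)) (g i j)
    rw [abs_sub_comm] at h3
    nlinarith
  have hPall : ∀ i ≤ m + j, |P.eval (i : ℝ)| ≤ (K + R) * 17496 ^ l := by
    intro i hi
    refine (abs_eval_le_of_abs_eval_le_on P S (m + j) i _ (by rwa [hScard])
      (fun s hs => (hS s hs).1) hi hPS).trans ?_
    rw [hScard]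
    have h1 : (j : ℝ) ≤ 2 ^ l := by exact_mod_cast hj2.trans Nat.lt_two_pow_self.le
    have h2 : (2 : ℝ) ≤ 2 ^ l := by
      simpa using pow_le_pow_right₀ (by norm_num : (1 : ℝ) ≤ 2) hl
    have h3 : (2 : ℝ) ^ j ≤ 2 ^ l := pow_le_pow_right₀ (by norm_num) hj2
    have h4 : (3 : ℝ) ^ (m + j) ≤ 27 ^ l := by
      rw [show (27 : ℝ) = 3 ^ 3 by norm_num, ← pow_mul]
      exact pow_le_pow_right₀ (by norm_num) (by omega)
    calc (j : ℝ) * (2 * ((K + R) * 81 ^ l) * (2 ^ j * 3 ^ (m + j)))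
        ≤ 2 ^ l * (2 ^ l * ((K + R) * 81 ^ l) * (2 ^ l * 27 ^ l)) := by gcongr
      _ = (K + R) * (2 * 2 * 81 * 2 * 27) ^ l := by simp only [mul_pow]; ring
      _ = (K + R) * 17496 ^ l := by norm_num
  set M : ℝ := (K + R) * (2 * 17496) ^ l with hM
  have hRM : R ≤ M := by
    have : (1 : ℝ) ≤ (2 * 17496) ^ l := one_le_pow₀ (by norm_num)
    nlinarith
  have hrow : ∀ i ≤ m + j, |v i j| ≤ M := by
    intro i hi
    have h1 := hPg i hi
    have h2 := hPall i hi
    have h3 := abs_sub_abs_le_abs_sub (g i j) (P.eval (i : ℝ))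
    have h4 : |g i j| = |v i j| := hsign i _
    have h5 : (81 : ℝ) ^ l ≤ 17496 ^ l := pow_le_pow_left₀ (by norm_num) (by norm_num) _
    have h6 : (2 : ℝ) ≤ 2 ^ l := by
      simpa using pow_le_pow_right₀ (by norm_num : (1 : ℝ) ≤ 2) hl
    have h7 : (K + R) * 81 ^ l ≤ (K + R) * 17496 ^ l := mul_le_mul_of_nonneg_left h5 hKR.le
    have h8 : 2 * ((K + R) * 17496 ^ l) ≤ 2 ^ l * ((K + R) * 17496 ^ l) := by gcongr
    rw [hM, mul_pow]
    linarith
  have hup : ∀ k ≤ j, ∀ i ≤ m + (j - k), |v i (j - k)| ≤ M * 3 ^ k := by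
    intro k
    induction k with
    | zero => intro _ i hi; simpa using hrow i hi
    | succ k ih =>
      intro hk i hi
      have e : j - k = j - (k + 1) + 1 := by omega
      have h1 := ih (by omega) i (by omega)
      have h2 := ih (by omega) (i + 1) (by omega)
      have h3 := hvrec (j - (k + 1)) (by omega) i hi
      rw [← e] at h3
      have h4 : M ≤ M * 3 ^ k :=
        le_mul_of_one_le_right (hR.le.trans hRM) (one_le_pow₀ (by norm_num))
      rw [pow_succ]
      rw [abs_le] at *
      constructor <;> linarith
  obtain ⟨i, t, ht, hi, rfl⟩ := (mem_Pset_iff _ _ _ _).1 hb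
  have h := hup (j - t) (by omega) i (by omega)
  rw [show j - (j - t) = t by omega] at h
  refine h.trans ?_
  calc M * 3 ^ (j - t) ≤ M * 3 ^ l := by
        refine mul_le_mul_of_nonneg_left ?_ (hR.le.trans hRM)
        exact pow_le_pow_right₀ (by norm_num) (by omega)
    _ = (K + R) * (2 * 17496 * 3) ^ l := by rw [hM, mul_pow _ 3]; ring
    _ = (K + R) * 104976 ^ l := by norm_num
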